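/- There exists a constant C > 0 such that for every integer n ≥ 2 and every δ ∈ ℝ² for which the set D = {G₂ f/l + δ : f ∈ ℤ²} ∩ [0,1]² with l = (√3·n/2)^{1/2} has exactly n elements, the extreme discrepancy of D satisfies P(D) ≤ C·n^{−1}·log(n). -/

import Mathlib

open Matrix

/-- The generator matrix `G₂` of the 15-degree rotated hexagonal lattice. -/
noncomputable def G₂ : Matrix (Fin 2) (Fin 2) ℝ :=
  !![(Real.sqrt 3 - 1) / (2 * Real.sqrt 2), -(Real.sqrt 3 + 1) / (2 * Real.sqrt 2);
     -(Real.sqrt 3 + 1) / (2 * Real.sqrt 2), (Real.sqrt 3 - 1) / (2 * Real.sqrt 2)]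

def Box (L M p q r s : ℝ) : Set (ℤ × ℤ) :=
  {f | (p ≤ (f.1 : ℝ) - L * f.2 ∧ (f.1 : ℝ) - L * f.2 < q) ∧
       (r ≤ M * f.2 - f.1 ∧ M * f.2 - (f.1 : ℝ) < s)}

def Good (L M T p q r s : ℝ) : Prop :=
  (Box L M p q r s).Finite ∧
    |((Box L M p q r s).ncard : ℝ) - (q - p) * (s - r) / (L - M)| ≤ T

lemma good_one (L M p r s : ℝ) (hk : 1 ≤ L - M) (hrs : r ≤ s) :
    Good L M 2 p (p + 1) r s := by
  have hk0 : 0 < L - M := by linarith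
  set A : Set ℤ := {m | r ≤ M * m - (⌈p + L * m⌉ : ℝ) ∧ M * m - (⌈p + L * m⌉ : ℝ) < s} with hA
  have himg : Box L M p (p + 1) r s = (fun m : ℤ => (⌈p + L * m⌉, m)) '' A := by
    ext ⟨f, m⟩
    simp only [Box, hA, Set.mem_ofPred_eq, Set.mem_image, Prod.mk.injEq]
    constructor
    · rintro ⟨⟨h1, h2⟩, h3, h4⟩
      have hc : ⌈p + L * m⌉ = f := by
        rw [Int.ceil_eq_iff]
        constructor <;> linarith
      exact ⟨m, by rw [hc]; exact ⟨h3, h4⟩, hc, rfl⟩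
    · rintro ⟨m', ⟨h3, h4⟩, hc, rfl⟩
      rw [hc] at h3 h4
      have := Int.ceil_eq_iff.1 hc
      refine ⟨⟨by linarith [this.2], by linarith [this.1]⟩, h3, h4⟩
  have hinj : Function.Injective (fun m : ℤ => (⌈p + L * m⌉, m)) := by
    intro a b h
    exact (Prod.mk.injEq _ _ _ _ ▸ h : _ ∧ _).2
  set U : Finset ℤ := Finset.Ioc ⌊(-p - s - 1) / (L - M)⌋ ⌊(-p - r) / (L - M)⌋ with hU
  set V : Finset ℤ := Finset.Ioc ⌊(-p - s) / (L - M)⌋ ⌊(-p - r - 1) / (L - M)⌋ with hV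
  have hAU : A ⊆ (U : Set ℤ) := by
    rintro m ⟨h1, h2⟩
    have c1 := Int.le_ceil (p + L * m)
    have c2 := Int.ceil_lt_add_one (p + L * m)
    simp only [hU, Finset.coe_Ioc, Set.mem_Ioc]
    rw [Int.floor_lt, Int.le_floor, div_lt_iff₀ hk0, le_div_iff₀ hk0]
    constructor <;> nlinarith
  have hVA : (V : Set ℤ) ⊆ A := by
    intro m hm
    have c1 := Int.le_ceil (p + L * m)
    have c2 := Int.ceil_lt_add_one (p + L * m)
    simp only [hV, Finset.coe_Ioc, Set.mem_Ioc] at hm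
    rw [Int.floor_lt, Int.le_floor, div_lt_iff₀ hk0, le_div_iff₀ hk0] at hm
    obtain ⟨h1, h2⟩ := hm
    constructor <;> nlinarith
  have hfin : A.Finite := U.finite_toSet.subset hAU
  refine ⟨himg ▸ hfin.image _, ?_⟩
  rw [himg, Set.ncard_image_of_injective _ hinj]
  have k1 : A.ncard ≤ U.card := by
    rw [← Set.ncard_coe_finset]; exact Set.ncard_le_ncard hAU U.finite_toSet
  have k2 : V.card ≤ A.ncard := by
    rw [← Set.ncard_coe_finset]; exact Set.ncard_le_ncard hVA hfin
  rw [hU, Int.card_Ioc] at k1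
  rw [hV, Int.card_Ioc] at k2
  have e1 : (-p - s - 1) / (L - M) = -p / (L - M) - s / (L - M) - 1 / (L - M) := by ring
  have e2 : (-p - r) / (L - M) = -p / (L - M) - r / (L - M) := by ring
  have e3 : (-p - s) / (L - M) = -p / (L - M) - s / (L - M) := by ring
  have e4 : (-p - r - 1) / (L - M) = -p / (L - M) - r / (L - M) - 1 / (L - M) := by ring
  have e5 : (p + 1 - p) * (s - r) / (L - M) = s / (L - M) - r / (L - M) := by ring
  have hq : 1 / (L - M) ≤ 1 := by rw [div_le_one hk0]; exact hk
  have hrs' : r / (L - M) ≤ s / (L - M) := by gcongr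
  rw [e5]
  rw [e1, e2] at k1
  rw [e3, e4] at k2
  have hq0 : 0 < 1 / (L - M) := by positivity
  generalize -p / (L - M) = P at *
  generalize r / (L - M) = R at *
  generalize s / (L - M) = S at *
  generalize 1 / (L - M) = Q at *
  have f1 := Int.lt_floor_add_one (P - S - Q)
  have f2 := Int.floor_le (P - R)
  have f3 := Int.floor_le (P - S)
  have f4 := Int.lt_floor_add_one (P - R - Q)
  have k1' : (A.ncard : ℤ) ≤ max (⌊P - R⌋ - ⌊P - S - Q⌋) 0 := by omega
  have k2' : ⌊P - R - Q⌋ - ⌊P - S⌋ ≤ (A.ncard : ℤ) := by omega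
  have k1'' : (A.ncard : ℝ) ≤ max ((⌊P - R⌋ : ℝ) - ⌊P - S - Q⌋) 0 := by exact_mod_cast k1'
  have k2'' : (⌊P - R - Q⌋ : ℝ) - ⌊P - S⌋ ≤ (A.ncard : ℝ) := by exact_mod_cast k2'
  rw [abs_le]
  constructor
  · linarith
  · rcases le_max_iff.1 k1'' with h | h <;> linarith

def Bd (L M w : ℝ) : Prop := ∀ p r s : ℝ, r ≤ s → Good L M 2 p (p + w) r s

/-- multiplication by the unit -/
def mulU (f : ℤ × ℤ) : ℤ × ℤ := (f.2, 4 * f.2 - f.1)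

def mulV (f : ℤ × ℤ) : ℤ × ℤ := (4 * f.1 - f.2, f.1)

lemma mulU_inj : Function.Injective mulU := by
  rintro ⟨a, b⟩ ⟨c, d⟩ h
  simp only [mulU, Prod.mk.injEq] at h
  ext <;> simp <;> omega

lemma mulUV (f) : mulU (mulV f) = f := by
  ext <;> simp [mulU, mulV]

lemma box_image (L M p q r s : ℝ) (h4 : L + M = 4) (h1 : L * M = 1) (hL : 0 < L) (hM : 0 < M) :
    Box L M (L * p) (L * q) (M * r) (M * s) = mulU '' Box L M p q r s := by
  have key : ∀ f : ℤ × ℤ, f ∈ Box L M p q r s ↔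
      mulU f ∈ Box L M (L * p) (L * q) (M * r) (M * s) := by
    rintro ⟨a, b⟩
    have e1 : (b : ℝ) - L * ((4 * b - a : ℤ) : ℝ) = L * (a - L * b) := by
      push_cast
      have : L * L = 4 * L - 1 := by rw [← h4, ← h1]; ring
      linear_combination (b : ℝ) * this
    have e2 : M * ((4 * b - a : ℤ) : ℝ) - (b : ℝ) = M * (M * b - a) := by
      push_cast
      have : M * M = 4 * M - 1 := by rw [← h4, ← h1]; ring
      linear_combination -(b : ℝ) * this
    simp only [Box, mulU, Set.mem_ofPred_eq, e1, e2]
    rw [mul_le_mul_iff_right₀ hL, mul_lt_mul_iff_right₀ hL, mul_le_mul_iff_right₀ hM,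
      mul_lt_mul_iff_right₀ hM]
  ext f
  constructor
  · intro h
    exact ⟨mulV f, by rw [key, mulUV]; exact h, mulUV f⟩
  · rintro ⟨g, hg, rfl⟩
    exact (key g).1 hg

lemma good_scale (L M T p q r s : ℝ) (h4 : L + M = 4) (h1 : L * M = 1) (hL : 0 < L) (hM : 0 < M) :
    Good L M T (L * p) (L * q) (M * r) (M * s) ↔ Good L M T p q r s := by
  unfold Good
  rw [box_image L M p q r s h4 h1 hL hM, Set.ncard_image_of_injective _ mulU_inj,
    Set.finite_image_iff mulU_inj.injOn]
  have : (L * q - L * p) * (M * s - M * r) = (q - p) * (s - r) := by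
    linear_combination (q - p) * (s - r) * h1
  rw [this]

lemma bd_up (L M w : ℝ) (h4 : L + M = 4) (h1 : L * M = 1) (hL : 0 < L) (hM : 0 < M)
    (h : Bd L M w) : Bd L M (L * w) := by
  intro p r s hrs
  have := (good_scale L M 2 (M * p) (M * p + w) (L * r) (L * s) h4 h1 hL hM).2
    (h _ _ _ (by gcongr))
  have e1 : L * (M * p) = p := by linear_combination p * h1
  have e2 : M * (L * r) = r := by linear_combination r * h1
  have e3 : M * (L * s) = s := by linear_combination s * h1
  rwa [mul_add, e1, e2, e3] at this

lemma bd_down (L M w : ℝ) (h4 : L + M = 4) (h1 : L * M = 1) (hL : 0 < L) (hM : 0 < M)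
    (h : Bd L M w) : Bd L M (M * w) := by
  intro p r s hrs
  have := (good_scale L M 2 p (p + M * w) r s h4 h1 hL hM).1 (by
    have e1 : L * (M * w) = w := by linear_combination w * h1
    rw [mul_add, e1]
    exact h _ _ _ (by gcongr))
  exact this

lemma good_add (L M T T' p q q' r s : ℝ) (hpq : p ≤ q) (hq : q ≤ q')
    (h : Good L M T p q r s) (h' : Good L M T' q q' r s) : Good L M (T + T') p q' r s := by
  have hu : Box L M p q' r s = Box L M p q r s ∪ Box L M q q' r s := by
    ext f
    simp only [Box, Set.mem_ofPred_eq, Set.mem_union]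
    constructor
    · rintro ⟨⟨h1, h2⟩, h3⟩
      rcases lt_or_ge ((f.1 : ℝ) - L * f.2) q with h | h
      · exact Or.inl ⟨⟨h1, h⟩, h3⟩
      · exact Or.inr ⟨⟨h, h2⟩, h3⟩
    · rintro (⟨⟨h1, h2⟩, h3⟩ | ⟨⟨h1, h2⟩, h3⟩)
      · exact ⟨⟨h1, by linarith⟩, h3⟩
      · exact ⟨⟨by linarith, h2⟩, h3⟩
  have hd : Disjoint (Box L M p q r s) (Box L M q q' r s) := by
    rw [Set.disjoint_left]
    rintro f ⟨⟨_, h2⟩, _⟩ ⟨⟨h3, _⟩, _⟩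
    linarith
  refine ⟨hu ▸ h.1.union h'.1, ?_⟩
  rw [hu, Set.ncard_union_eq hd h.1 h'.1]
  have e : (q' - p) * (s - r) / (L - M) =
    (q - p) * (s - r) / (L - M) + (q' - q) * (s - r) / (L - M) := by ring
  rw [e]
  push_cast
  have a := abs_le.1 h.2
  have b := abs_le.1 h'.2
  rw [abs_le]
  constructor <;> linarith [a.1, a.2, b.1, b.2]

lemma good_steps (L M w T r s : ℝ) (hw : 0 ≤ w) (hrs : r ≤ s) (hb : Bd L M w)
    (h : ∀ p q, p ≤ q → q ≤ p + w → Good L M T p q r s) (c : ℕ) :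
    ∀ p q, p ≤ q → q ≤ p + (c + 1) * w → Good L M (T + 2 * c) p q r s := by
  induction c with
  | zero => intro p q hp hq; simpa using h p q hp (by simpa using hq)
  | succ c ih =>
    intro p q hp hq
    push_cast at hq ⊢
    rcases le_total q (p + w) with h1 | h1
    · have := h p q hp h1
      refine ⟨this.1, this.2.trans ?_⟩
      have : (0 : ℝ) ≤ c := by positivity
      linarith
    · have := good_add L M 2 (T + 2 * c) p (p + w) q r s (by linarith) h1 (hb p r s hrs)
        (ih (p + w) q h1 (by linarith))
      convert this using 1
      ring

lemma good_main (L M : ℝ) (h4 : L + M = 4) (h1 : L * M = 1) (hk : 1 ≤ L - M) (hM : 0 < M)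
    (j : ℕ) (p q r s : ℝ) (hpq : p ≤ q) (hrs : r ≤ s) (hq : q - p ≤ L ^ j) (hs : s - r ≤ L ^ j) :
    Good L M (3 + 12 * j) p q r s := by
  have hL : 0 < L := by linarith
  have hk0 : 0 < L - M := by linarith
  have bone : Bd L M 1 := fun p r s hrs => good_one L M p r s hk hrs
  have bdn : ∀ k : ℕ, Bd L M (M ^ k) := by
    intro k
    induction k with
    | zero => simpa using bone
    | succ k ih => rw [pow_succ']; exact bd_down L M _ h4 h1 hL hM ih
  have bup : ∀ k : ℕ, Bd L M (L ^ k * M ^ j) := by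
    intro k
    induction k with
    | zero => simpa using bdn j
    | succ k ih => rw [pow_succ', mul_assoc]; exact bd_up L M _ h4 h1 hL hM ih
  have hLM : M ^ j * L ^ j = 1 := by rw [← mul_pow, mul_comm, h1, one_pow]
  have base : ∀ p q, p ≤ q → q ≤ p + M ^ j → Good L M 3 p q r s := by
    intro p q hp hq
    have hg := bdn j p r s hrs
    have hsub : Box L M p q r s ⊆ Box L M p (p + M ^ j) r s := by
      rintro f ⟨⟨a, b⟩, c⟩
      exact ⟨⟨a, by linarith⟩, c⟩
    refine ⟨hg.1.subset hsub, ?_⟩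
    have hc : ((Box L M p q r s).ncard : ℝ) ≤ (Box L M p (p + M ^ j) r s).ncard := by
      exact_mod_cast Set.ncard_le_ncard hsub hg.1
    have h2 := (abs_le.1 hg.2).2
    have hMj : 0 < M ^ j := by positivity
    have ha : (p + M ^ j - p) * (s - r) / (L - M) ≤ 1 := by
      rw [div_le_one hk0]
      have : M ^ j * (s - r) ≤ M ^ j * L ^ j := by gcongr
      nlinarith
    have hb : (q - p) * (s - r) / (L - M) ≤ (p + M ^ j - p) * (s - r) / (L - M) := by
      have : 0 ≤ s - r := by linarith
      gcongr
    have hb0 : 0 ≤ (q - p) * (s - r) / (L - M) := by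
      have : 0 ≤ s - r := by linarith
      have : 0 ≤ q - p := by linarith
      positivity
    have hc0 : (0 : ℝ) ≤ (Box L M p q r s).ncard := by positivity
    rw [abs_le]
    constructor <;> linarith
  have step : ∀ k : ℕ, ∀ p q, p ≤ q → q ≤ p + L ^ k * M ^ j → Good L M (3 + 6 * k) p q r s := by
    intro k
    induction k with
    | zero => simpa using base
    | succ k ih =>
      intro p q hp hq
      have hw : 0 ≤ L ^ k * M ^ j := by positivity
      have := good_steps L M _ _ r s hw hrs (bup k) ih 3 p q hp (by
        rw [pow_succ', mul_assoc] at hq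
        have : L * (L ^ k * M ^ j) ≤ 4 * (L ^ k * M ^ j) := by gcongr; linarith
        push_cast
        linarith)
      convert this using 1
      push_cast
      ring
  have := step (2 * j) p q hpq (by
    have : L ^ (2 * j) * M ^ j = L ^ j := by
      rw [two_mul, pow_add, mul_assoc, mul_comm (L ^ j) (M ^ j), hLM, mul_one]
    rw [this]; linarith)
  convert this using 1
  push_cast
  ring

set_option maxHeartbeats 2000000 in
/-- Theorem 4(i) of He (2017): there is a constant `C > 0` such that the extreme
discrepancy of every `n`-point rotated sphere packing design with the magic angle is
at most `C n⁻¹ log n`. -/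
theorem magic_angle_discrepancy_bound :
    ∃ C : ℝ, 0 < C ∧
      ∀ n : ℕ, 2 ≤ n → ∀ δ : Fin 2 → ℝ, ∀ D : Set (Fin 2 → ℝ),
        D = {x | (∃ f : Fin 2 → ℤ, ∀ i,
            x i = G₂.mulVec (fun j => (f j : ℝ)) i / Real.sqrt (Real.sqrt 3 * n / 2) + δ i) ∧
          ∀ i, x i ∈ Set.Icc (0 : ℝ) 1} →
        D.ncard = n →
        ∀ u v : Fin 2 → ℝ, (∀ k, 0 ≤ u k) → (∀ k, v k ≤ 1) → (∀ k, u k < v k) →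
          |(Set.ncard {x ∈ D | ∀ k, u k ≤ x k ∧ x k < v k} : ℝ) / n -
              (v 0 - u 0) * (v 1 - u 1)| ≤ C * (n : ℝ)⁻¹ * Real.log n := by
  have s3 : Real.sqrt 3 * Real.sqrt 3 = 3 := Real.mul_self_sqrt (by norm_num)
  have s2 : Real.sqrt 2 * Real.sqrt 2 = 2 := Real.mul_self_sqrt (by norm_num)
  have p2 : 0 < Real.sqrt 2 := by positivity
  have p3 : 0 < Real.sqrt 3 := by positivity
  have g3 : 1.7 < Real.sqrt 3 := by rw [Real.lt_sqrt] <;> norm_num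
  have l3 : Real.sqrt 3 < 1.8 := by rw [Real.sqrt_lt'] <;> norm_num
  have l2 : Real.sqrt 2 < 1.42 := by rw [Real.sqrt_lt'] <;> norm_num
  set a : ℝ := (Real.sqrt 3 - 1) / (2 * Real.sqrt 2) with ha
  set b : ℝ := (Real.sqrt 3 + 1) / (2 * Real.sqrt 2) with hb
  set L : ℝ := 2 + Real.sqrt 3 with hL
  set M : ℝ := 2 - Real.sqrt 3 with hM
  have ga : 0.23 < a := by rw [ha, lt_div_iff₀ (by positivity)]; linarith
  have gb : 0.23 < b := by rw [hb, lt_div_iff₀ (by positivity)]; linarith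
  have hab : a * b = 1 / 4 := by
    rw [ha, hb]; field_simp
    nlinarith
  have haL : a * L = b := by
    rw [ha, hb, hL]; field_simp; nlinarith
  have hbM : b * M = a := by
    rw [ha, hb, hM]; field_simp; nlinarith
  have h4 : L + M = 4 := by rw [hL, hM]; ring
  have h1 : L * M = 1 := by rw [hL, hM]; nlinarith
  have hLM : L - M = 2 * Real.sqrt 3 := by rw [hL, hM]; ring
  clear_value a b L M
  refine ⟨102, by norm_num, ?_⟩
  intro n hn δ D hD _ u v hu hv huv
  have hn' : (2 : ℝ) ≤ n := by exact_mod_cast hn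
  set l : ℝ := Real.sqrt (Real.sqrt 3 * n / 2) with hl
  have hl2 : l * l = Real.sqrt 3 * n / 2 := Real.mul_self_sqrt (by positivity)
  have hl0 : 0 < l := by rw [hl]; positivity
  clear_value l
  have hln : l ≤ n * 0.92 := by
    by_contra! h
    nlinarith
  have ha0 : 0 < a := by linarith
  have hb0 : 0 < b := by linarith
  set p := (u 0 - δ 0) * l / a with hp
  set q := (v 0 - δ 0) * l / a with hq
  set r := (u 1 - δ 1) * l / b with hr
  set s := (v 1 - δ 1) * l / b with hs
  let φ : ℤ × ℤ → (Fin 2 → ℝ) := fun f =>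
    ![a * (f.1 - L * f.2) / l + δ 0, b * (M * f.2 - f.1) / l + δ 1]
  have hφ : Function.Injective φ := by
    rintro ⟨f, g⟩ ⟨f', g'⟩ h
    have e0 := congrFun h 0
    have e1 := congrFun h 1
    simp only [φ, Matrix.cons_val_zero, Matrix.cons_val_one] at e0 e1
    field_simp at e0 e1
    have e0' : (f : ℝ) - L * g = f' - L * g' := by
      apply mul_left_cancel₀ ha0.ne'; linarith
    have e1' : M * g - (f : ℝ) = M * g' - f' := by
      apply mul_left_cancel₀ hb0.ne'; linarith
    have : (L - M) * ((g : ℝ) - g') = 0 := by linarith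
    have hg : (g : ℝ) = g' := by
      rcases mul_eq_zero.1 this with h | h <;> linarith
    have hf : (f : ℝ) = f' := by rw [hg] at e0'; linarith
    ext
    · exact_mod_cast hf
    · exact_mod_cast hg
  have hset : {x ∈ D | ∀ k, u k ≤ x k ∧ x k < v k} = φ '' Box L M p q r s := by
    have i1 : ∀ t c d e : ℝ, 0 < e → ((c - d) * l / e ≤ t ↔ c ≤ e * t / l + d) := by
      intro t c d e he
      rw [div_le_iff₀ he, ← sub_le_iff_le_add, le_div_iff₀ hl0, mul_comm t e]
    have i2 : ∀ t c d e : ℝ, 0 < e → (t < (c - d) * l / e ↔ e * t / l + d < c) := by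
      intro t c d e he
      rw [lt_div_iff₀ he, ← lt_sub_iff_add_lt, div_lt_iff₀ hl0, mul_comm t e]
    have hnb : (-1 + -Real.sqrt 3) / (2 * Real.sqrt 2) = -b := by rw [hb]; ring
    have hG : ∀ f : Fin 2 → ℤ, ∀ i, G₂.mulVec (fun j => (f j : ℝ)) i / l + δ i
        = φ (f 0, f 1) i := by
      intro f i
      fin_cases i
      · simp [G₂, Matrix.mulVec, dotProduct, Fin.sum_univ_two, φ]
        rw [hnb, ← ha, ← haL]; ring
      · simp [G₂, Matrix.mulVec, dotProduct, Fin.sum_univ_two, φ]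
        rw [hnb, ← ha, ← hbM]; ring
    have hmem : ∀ f : ℤ × ℤ, f ∈ Box L M p q r s ↔ ∀ k, u k ≤ φ f k ∧ φ f k < v k := by
      intro f
      simp only [Box, Set.mem_ofPred_eq, Fin.forall_fin_two, hp, hq, hr, hs, φ,
        Matrix.cons_val_zero, Matrix.cons_val_one]
      rw [i1 _ _ _ _ ha0, i1 _ _ _ _ hb0, i2 _ _ _ _ ha0, i2 _ _ _ _ hb0]
    ext x
    rw [hD]
    simp only [Set.mem_ofPred_eq, Set.mem_image, hG]
    constructor
    · rintro ⟨⟨⟨f, hf⟩, _⟩, hx⟩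
      have : x = φ (f 0, f 1) := funext hf
      subst this
      exact ⟨_, (hmem _).2 hx, rfl⟩
    · rintro ⟨f, hf, rfl⟩
      have hf' := (hmem _).1 hf
      refine ⟨⟨⟨![f.1, f.2], fun i => by simp⟩, fun i => ?_⟩, hf'⟩
      exact ⟨(hu i).trans (hf' i).1, (hf' i).2.le.trans (hv i)⟩
  rw [hset, Set.ncard_image_of_injective _ hφ]
  have eqp : q - p = (v 0 - u 0) * l / a := by rw [hp, hq]; ring
  have esr : s - r = (v 1 - u 1) * l / b := by rw [hr, hs]; ring
  have w0 : 0 < v 0 - u 0 := by linarith [huv 0]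
  have w1 : 0 < v 1 - u 1 := by linarith [huv 1]
  have w0' : v 0 - u 0 ≤ 1 := by linarith [hu 0, hv 0]
  have w1' : v 1 - u 1 ≤ 1 := by linarith [hu 1, hv 1]
  have hqp0 : 0 < (v 0 - u 0) * l / a := by positivity
  have hsr0 : 0 < (v 1 - u 1) * l / b := by positivity
  have hj : 4 * (n : ℝ) ≤ L ^ (Nat.log 2 n + 3) := by
    have h2 : n < 2 ^ (Nat.log 2 n + 1) := Nat.lt_pow_succ_log_self (by norm_num) n
    have h3 : 4 * n ≤ 2 ^ (Nat.log 2 n + 3) := by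
      rw [show Nat.log 2 n + 3 = (Nat.log 2 n + 1) + 2 by ring, pow_add _ _ 2]; omega
    have h3' : (4 : ℝ) * n ≤ 2 ^ (Nat.log 2 n + 3) := by exact_mod_cast h3
    refine h3'.trans ?_
    gcongr
    linarith
  have main := (good_main L M h4 h1 (by linarith) (by linarith) (Nat.log 2 n + 3) p q r s
    (by linarith) (by linarith)
    (by
      refine le_trans ?_ hj
      rw [eqp, div_le_iff₀ ha0]
      nlinarith)
    (by
      refine le_trans ?_ hj
      rw [esr, div_le_iff₀ hb0]
      nlinarith)).2
  have area : (q - p) * (s - r) / (L - M) = n * ((v 0 - u 0) * (v 1 - u 1)) := by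
    rw [eqp, esr, hLM]
    have : (v 0 - u 0) * l / a * ((v 1 - u 1) * l / b)
      = (v 0 - u 0) * (v 1 - u 1) * (l * l) / (a * b) := by field_simp
    rw [this, hl2, hab]
    field_simp
    ring
  rw [area] at main
  have hn0 : (0 : ℝ) < n := by linarith
  have e : ((Box L M p q r s).ncard : ℝ) / n - (v 0 - u 0) * (v 1 - u 1)
      = (((Box L M p q r s).ncard : ℝ) - n * ((v 0 - u 0) * (v 1 - u 1))) / n := by
    field_simp
  rw [e, abs_div, abs_of_pos hn0, div_le_iff₀ hn0]
  refine main.trans ?_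
  have e2 : 102 * (n : ℝ)⁻¹ * Real.log n * n = 102 * Real.log n := by field_simp
  rw [e2]
  have k1 : 1 ≤ Nat.log 2 n := Nat.log_pos (by norm_num) hn
  have k1' : (1 : ℝ) ≤ Nat.log 2 n := by exact_mod_cast k1
  have k2 : (Nat.log 2 n : ℝ) * Real.log 2 ≤ Real.log n := by
    rw [← Real.log_pow]
    apply Real.log_le_log (by positivity)
    exact_mod_cast Nat.pow_log_le_self 2 (by omega)
  have k3 := Real.log_two_gt_d9
  push_cast
  nlinarith
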